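/- arXiv:2412.20609 — 3 statements merged into one kernel-verified Lean document; each statement's English description precedes it below -/
import Mathlib

section
/- Let R be either L or H, and let S be a nonempty proper subset of R with S ⊆ C_R(m) for some monic quadratic m ∈ ℤ[x]. If every polynomial of degree 1 in Int(S,R) belongs to Int(S*,R), then S is a ringset of R. -/
noncomputable section

open Polynomial

abbrev 𝔻 : Type := Quaternion ℚ

def qi : 𝔻 := QuaternionAlgebra.mk 0 1 0 0
def qj : 𝔻 := QuaternionAlgebra.mk 0 0 1 0
def qk : 𝔻 := QuaternionAlgebra.mk 0 0 0 1

def isIntQ (q : ℚ) : Prop := ∃ z : ℤ, q = (z : ℚ)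
def isHalfOddQ (q : ℚ) : Prop := ∃ z : ℤ, q = (z : ℚ) + 1/2

def Lip : Set 𝔻 :=
  {α | isIntQ α.re ∧ isIntQ α.imI ∧ isIntQ α.imJ ∧ isIntQ α.imK}

def HurOff : Set 𝔻 :=
  {α | isHalfOddQ α.re ∧ isHalfOddQ α.imI ∧ isHalfOddQ α.imJ ∧ isHalfOddQ α.imK}

def Hur : Set 𝔻 := Lip ∪ HurOff

def qnorm (α : 𝔻) : ℚ := α.re ^ 2 + α.imI ^ 2 + α.imJ ^ 2 + α.imK ^ 2

def minPoly (α : 𝔻) : Polynomial ℚ :=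
  if α.imI = 0 ∧ α.imJ = 0 ∧ α.imK = 0 then X - C α.re
  else X ^ 2 - C (2 * α.re) * X + C (qnorm α)

def classOf (R : Set 𝔻) (m : Polynomial ℤ) : Set 𝔻 :=
  {α | α ∈ R ∧ minPoly α = m.map (Int.castRingHom ℚ)}

def IntPolys (S R : Set 𝔻) : Set (Polynomial 𝔻) :=
  {f | ∀ α ∈ S, f.eval α ∈ R}

def IsRingset (S R : Set 𝔻) : Prop :=
  ∀ f ∈ IntPolys S R, ∀ g ∈ IntPolys S R, f * g ∈ IntPolys S R

def transSet (S : Set 𝔻) (a : ℤ) : Set 𝔻 := (fun α => α + (a : 𝔻)) '' S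

def scaleSet (n : ℤ) (R : Set 𝔻) : Set 𝔻 := (fun α => (n : 𝔻) * α) '' R

def IsReducedIn (S R : Set 𝔻) : Prop :=
  (∃ m : Polynomial ℤ, m.Monic ∧ m.natDegree = 2 ∧ S ⊆ classOf R m) ∧
  (∀ a n : ℤ, 2 ≤ n → ¬ (transSet S a ⊆ scaleSet n R))

def diffs (S : Set 𝔻) : Set 𝔻 := {δ | ∃ α ∈ S, ∃ β ∈ S, δ = α - β}

def normsOf (S : Set 𝔻) : Set ℤ := {n : ℤ | ∃ δ ∈ diffs S, (n : ℚ) = qnorm δ}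

def gam (S : Set 𝔻) : ℕ := sSup {g : ℕ | ∀ t ∈ normsOf S, (g : ℤ) ∣ t}

def starSet (S R : Set 𝔻) : Set 𝔻 :=
  {β | ∃ α ∈ S, ∃ u v : 𝔻, u ∈ R ∧ v ∈ R ∧ u * v = 1 ∧ v * u = 1 ∧ β = u * α * v}

def idealGen (R : Set 𝔻) (x : 𝔻) : Set 𝔻 :=
  {β | ∃ n : ℕ, ∃ a b : Fin n → 𝔻, (∀ k, a k ∈ R) ∧ (∀ k, b k ∈ R) ∧ β = ∑ k, a k * x * b k}

open scoped Quaternion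

@[simp] theorem qi_re : qi.re = 0 := rfl
@[simp] theorem qi_imI : qi.imI = 1 := rfl
@[simp] theorem qi_imJ : qi.imJ = 0 := rfl
@[simp] theorem qi_imK : qi.imK = 0 := rfl

@[simp] theorem qj_re : qj.re = 0 := rfl
@[simp] theorem qj_imI : qj.imI = 0 := rfl
@[simp] theorem qj_imJ : qj.imJ = 1 := rfl
@[simp] theorem qj_imK : qj.imK = 0 := rfl

@[simp] theorem qk_re : qk.re = 0 := rfl
@[simp] theorem qk_imI : qk.imI = 0 := rfl
@[simp] theorem qk_imJ : qk.imJ = 0 := rfl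
@[simp] theorem qk_imK : qk.imK = 1 := rfl

/-- The quaternion with the given integer coordinates. -/
def ofInts (a b c d : ℤ) : 𝔻 := QuaternionAlgebra.mk a b c d

@[simp] theorem ofInts_re (a b c d : ℤ) : (ofInts a b c d).re = a := rfl
@[simp] theorem ofInts_imI (a b c d : ℤ) : (ofInts a b c d).imI = b := rfl
@[simp] theorem ofInts_imJ (a b c d : ℤ) : (ofInts a b c d).imJ = c := rfl
@[simp] theorem ofInts_imK (a b c d : ℤ) : (ofInts a b c d).imK = d := rfl

theorem ofInts_mem_Lip (a b c d : ℤ) : ofInts a b c d ∈ Lip :=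
  ⟨⟨a, rfl⟩, ⟨b, rfl⟩, ⟨c, rfl⟩, ⟨d, rfl⟩⟩

theorem mem_Lip_iff {x : 𝔻} : x ∈ Lip ↔ ∃ a b c d : ℤ, x = ofInts a b c d := by
  constructor
  · rintro ⟨⟨a, ha⟩, ⟨b, hb⟩, ⟨c, hc⟩, ⟨d, hd⟩⟩
    exact ⟨a, b, c, d, by ext <;> simp [*]⟩
  · rintro ⟨a, b, c, d, rfl⟩
    exact ofInts_mem_Lip a b c d

/-- The set of units of a set `R` of rational quaternions. -/
def unitsIn (R : Set 𝔻) : Set 𝔻 := {u | u ∈ R ∧ ∃ v ∈ R, u * v = 1 ∧ v * u = 1}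

/-- The ring of Lipschitz quaternions. -/
def lipschitz : Subring 𝔻 where
  carrier := Lip
  zero_mem' := mem_Lip_iff.2 ⟨0, 0, 0, 0, by ext <;> simp⟩
  one_mem' := mem_Lip_iff.2 ⟨1, 0, 0, 0, by ext <;> simp⟩
  add_mem' := by
    intro x y hx hy
    obtain ⟨a, b, c, d, rfl⟩ := mem_Lip_iff.1 hx
    obtain ⟨a', b', c', d', rfl⟩ := mem_Lip_iff.1 hy
    exact mem_Lip_iff.2 ⟨a + a', b + b', c + c', d + d', by ext <;> simp⟩
  neg_mem' := by
    intro x hx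
    obtain ⟨a, b, c, d, rfl⟩ := mem_Lip_iff.1 hx
    exact mem_Lip_iff.2 ⟨-a, -b, -c, -d, by ext <;> simp⟩
  mul_mem' := by
    intro x y hx hy
    obtain ⟨a, b, c, d, rfl⟩ := mem_Lip_iff.1 hx
    obtain ⟨a', b', c', d', rfl⟩ := mem_Lip_iff.1 hy
    exact mem_Lip_iff.2 ⟨a * a' - b * b' - c * c' - d * d', a * b' + b * a' + c * d' - d * c',
      a * c' - b * d' + c * a' + d * b', a * d' + b * c' - c * b' + d * a', by ext <;> simp⟩

/-- The Hurwitz unit `(1 + i + j + k) / 2`. -/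
def qω : 𝔻 := QuaternionAlgebra.mk (1 / 2) (1 / 2) (1 / 2) (1 / 2)

@[simp] theorem qω_re : qω.re = 1 / 2 := rfl
@[simp] theorem qω_imI : qω.imI = 1 / 2 := rfl
@[simp] theorem qω_imJ : qω.imJ = 1 / 2 := rfl
@[simp] theorem qω_imK : qω.imK = 1 / 2 := rfl

theorem mem_Hur_iff {x : 𝔻} : x ∈ Hur ↔ ∃ y ∈ Lip, ∃ e : ℤ, x = y + e • qω := by
  constructor
  · rintro (h | ⟨⟨a, ha⟩, ⟨b, hb⟩, ⟨c, hc⟩, ⟨d, hd⟩⟩)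
    · exact ⟨x, h, 0, by simp⟩
    · refine ⟨ofInts a b c d, ofInts_mem_Lip a b c d, 1, ?_⟩
      ext <;> simp [*]
  · rintro ⟨y, ⟨⟨a, ha⟩, ⟨b, hb⟩, ⟨c, hc⟩, ⟨d, hd⟩⟩, e, rfl⟩
    obtain ⟨n, rfl | rfl⟩ := e.even_or_odd'
    · refine Or.inl ⟨⟨a + n, ?_⟩, ⟨b + n, ?_⟩, ⟨c + n, ?_⟩, ⟨d + n, ?_⟩⟩ <;>
        simp [two_mul, *] <;> ring
    · refine Or.inr ⟨⟨a + n, ?_⟩, ⟨b + n, ?_⟩, ⟨c + n, ?_⟩, ⟨d + n, ?_⟩⟩ <;>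
        simp [two_mul, *] <;> ring

theorem Lip_subset_Hur : Lip ⊆ Hur := Set.subset_union_left

theorem mul_qω_mem_Hur {y : 𝔻} (hy : y ∈ Lip) : y * qω ∈ Hur := by
  obtain ⟨a, b, c, d, rfl⟩ := mem_Lip_iff.1 hy
  refine mem_Hur_iff.2 ⟨_, ofInts_mem_Lip (-b - c - d) (-d) (-b) (-c), a + b + c + d, ?_⟩
  ext <;> simp <;> ring

theorem qω_mul_mem_Hur {y : 𝔻} (hy : y ∈ Lip) : qω * y ∈ Hur := by
  obtain ⟨a, b, c, d, rfl⟩ := mem_Lip_iff.1 hy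
  refine mem_Hur_iff.2 ⟨_, ofInts_mem_Lip (-b - c - d) (-c) (-d) (-b), a + b + c + d, ?_⟩
  ext <;> simp <;> ring

theorem qω_mem_Hur : qω ∈ Hur := by
  simpa using mul_qω_mem_Hur lipschitz.one_mem

theorem qω_mul_self : qω * qω = qω - 1 := by
  ext <;> simp <;> norm_num

/-- The additive group of Hurwitz quaternions. -/
def hurwitzAddSubgroup : AddSubgroup 𝔻 where
  carrier := Hur
  zero_mem' := Lip_subset_Hur lipschitz.zero_mem
  add_mem' := by
    intro x y hx hy
    obtain ⟨x, hx', e, rfl⟩ := mem_Hur_iff.1 hx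
    obtain ⟨y, hy', e', rfl⟩ := mem_Hur_iff.1 hy
    exact mem_Hur_iff.2 ⟨x + y, lipschitz.add_mem hx' hy', e + e', by module⟩
  neg_mem' := by
    intro x hx
    obtain ⟨x, hx', e, rfl⟩ := mem_Hur_iff.1 hx
    exact mem_Hur_iff.2 ⟨-x, lipschitz.neg_mem hx', -e, by module⟩

/-- The ring of Hurwitz quaternions. -/
def hurwitz : Subring 𝔻 where
  __ := hurwitzAddSubgroup
  one_mem' := Lip_subset_Hur lipschitz.one_mem
  mul_mem' := by
    intro x y hx hy
    obtain ⟨x, hx', e, rfl⟩ := mem_Hur_iff.1 hx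
    obtain ⟨y, hy', e', rfl⟩ := mem_Hur_iff.1 hy
    have hxy : x * y ∈ hurwitzAddSubgroup := Lip_subset_Hur (lipschitz.mul_mem hx' hy')
    have hxω : x * qω ∈ hurwitzAddSubgroup := mul_qω_mem_Hur hx'
    have hωy : qω * y ∈ hurwitzAddSubgroup := qω_mul_mem_Hur hy'
    have hω : qω ∈ hurwitzAddSubgroup := qω_mem_Hur
    have h1 : 1 ∈ hurwitzAddSubgroup := Lip_subset_Hur lipschitz.one_mem
    have key : (x + e • qω) * (y + e' • qω) =
        x * y + e' • (x * qω) + e • (qω * y) + (e * e') • (qω - 1) := by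
      rw [← qω_mul_self]
      simp only [add_mul, mul_add, smul_mul_assoc, mul_smul_comm]
      module
    change _ ∈ hurwitzAddSubgroup
    rw [key]
    exact add_mem (add_mem (add_mem hxy (zsmul_mem hxω _)) (zsmul_mem hωy _))
      (zsmul_mem (sub_mem hω h1) _)

theorem one_mem_unitsIn_Lip : 1 ∈ unitsIn Lip :=
  ⟨lipschitz.one_mem, 1, lipschitz.one_mem, by simp, by simp⟩

theorem mem_unitsIn_of_mul_self (A : Subring 𝔻) {u : 𝔻} (hu : u ∈ A) (h : u * u = -1) :
    u ∈ unitsIn (A : Set 𝔻) :=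
  ⟨hu, -u, A.neg_mem hu, by simp [h], by simp [h]⟩

theorem qi_mem_unitsIn_Lip : qi ∈ unitsIn Lip :=
  mem_unitsIn_of_mul_self lipschitz (mem_Lip_iff.2 ⟨0, 1, 0, 0, by ext <;> simp⟩) (by ext <;> simp)

theorem qj_mem_unitsIn_Lip : qj ∈ unitsIn Lip :=
  mem_unitsIn_of_mul_self lipschitz (mem_Lip_iff.2 ⟨0, 0, 1, 0, by ext <;> simp⟩) (by ext <;> simp)

theorem qk_mem_unitsIn_Lip : qk ∈ unitsIn Lip :=
  mem_unitsIn_of_mul_self lipschitz (mem_Lip_iff.2 ⟨0, 0, 0, 1, by ext <;> simp⟩) (by ext <;> simp)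

theorem qω_mem_unitsIn_Hur : qω ∈ unitsIn Hur := by
  refine ⟨qω_mem_Hur, 1 - qω, hurwitz.sub_mem hurwitz.one_mem qω_mem_Hur, ?_, ?_⟩ <;>
    simp [mul_sub, sub_mul, qω_mul_self]

theorem unitsIn_mono {R T : Set 𝔻} (h : R ⊆ T) : unitsIn R ⊆ unitsIn T :=
  fun _ ⟨hu, v, hv, huv⟩ => ⟨h hu, v, h hv, huv⟩

theorem Lip_subset_closure_units : Lip ⊆ AddSubgroup.closure (unitsIn Lip) := by
  intro x hx
  obtain ⟨a, b, c, d, rfl⟩ := mem_Lip_iff.1 hx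
  have hx : ofInts a b c d = a • 1 + b • qi + c • qj + d • qk := by
    ext <;> simp
  have mem {u : 𝔻} (hu : u ∈ unitsIn Lip) (n : ℤ) :
      n • u ∈ AddSubgroup.closure (unitsIn Lip) :=
    zsmul_mem (AddSubgroup.subset_closure hu) n
  rw [hx]
  exact add_mem (add_mem (add_mem (mem one_mem_unitsIn_Lip a) (mem qi_mem_unitsIn_Lip b))
    (mem qj_mem_unitsIn_Lip c)) (mem qk_mem_unitsIn_Lip d)

theorem Hur_subset_closure_units : Hur ⊆ AddSubgroup.closure (unitsIn Hur) := by
  intro x hx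
  obtain ⟨y, hy, e, rfl⟩ := mem_Hur_iff.1 hx
  exact add_mem
    (AddSubgroup.closure_mono (unitsIn_mono Lip_subset_Hur) (Lip_subset_closure_units hy))
    (zsmul_mem (AddSubgroup.subset_closure qω_mem_unitsIn_Hur) e)

theorem exists_pow_eq_smul_add_smul (t n : ℚ) (k : ℕ) :
    ∃ p q : ℚ, ∀ α : 𝔻, α * α = t • α + n • 1 → α ^ k = p • α + q • 1 := by
  induction k with
  | zero => exact ⟨0, 1, fun α _ => by simp⟩
  | succ k ih =>
    obtain ⟨p, q, h⟩ := ih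
    refine ⟨p * t + q, p * n, fun α hα => ?_⟩
    rw [pow_succ, h α hα, add_mul, smul_mul_assoc, hα, smul_mul_assoc, one_mul]
    module

/-- On the roots of a fixed central quadratic, left multiplication by a polynomial acts on
values as left multiplication by a linear polynomial does. -/
theorem exists_eval_mul_eq_linear (t n : ℚ) (f : 𝔻[X]) :
    ∃ a b : 𝔻, ∀ α : 𝔻, α * α = t • α + n • 1 → ∀ g : 𝔻[X],
      (f * g).eval α = a * g.eval α * α + b * g.eval α := by
  induction f using Polynomial.induction_on' with
  | add f₁ f₂ h₁ h₂ =>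
    obtain ⟨a₁, b₁, h₁⟩ := h₁
    obtain ⟨a₂, b₂, h₂⟩ := h₂
    refine ⟨a₁ + a₂, b₁ + b₂, fun α hα g => ?_⟩
    rw [add_mul, eval_add, h₁ α hα, h₂ α hα]
    noncomm_ring
  | monomial k c =>
    obtain ⟨p, q, h⟩ := exists_pow_eq_smul_add_smul t n k
    refine ⟨p • c, q • c, fun α hα g => ?_⟩
    rw [← C_mul_X_pow_eq_monomial, mul_assoc, X_pow_mul, ← mul_assoc, eval_mul_X_pow, eval_C_mul,
      h α hα]
    simp only [mul_add, mul_smul_comm, smul_mul_assoc, mul_one]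

theorem mul_self_eq_of_minPoly_eq {m : ℤ[X]} (hm : m.Monic) (hdeg : m.natDegree = 2) {α : 𝔻}
    (h : minPoly α = m.map (Int.castRingHom ℚ)) :
    α * α = (-(m.coeff 1 : ℚ)) • α + (-(m.coeff 0 : ℚ)) • 1 := by
  unfold minPoly at h
  split_ifs at h
  · have := congrArg natDegree h
    rw [natDegree_X_sub_C, hm.natDegree_map, hdeg] at this
    omega
  · have h0 : qnorm α = m.coeff 0 := by simpa using congrArg (coeff · 0) h
    have h1 : -(2 * α.re) = m.coeff 1 := by
      simpa [coeff_X, coeff_C, coeff_X_pow] using congrArg (coeff · 1) h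
    rw [← h0, ← h1]
    ext <;> simp [qnorm] <;> ring

theorem isRingset_of_linear {A : Subring 𝔻} (hA : (A : Set 𝔻) ⊆ AddSubgroup.closure (unitsIn A))
    {S : Set 𝔻} {m : ℤ[X]} (hm : m.Monic) (hdeg : m.natDegree = 2) (hcls : S ⊆ classOf A m)
    (hlin : ∀ f ∈ IntPolys S A, f.degree = 1 → f ∈ IntPolys (starSet S A) A) :
    IsRingset S A := by
  intro f hf g hg α hα
  obtain ⟨a, b, hab⟩ := exists_eval_mul_eq_linear (-(m.coeff 1 : ℚ)) (-(m.coeff 0 : ℚ)) f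
  have hroot : ∀ β ∈ S, β * β = (-(m.coeff 1 : ℚ)) • β + (-(m.coeff 0 : ℚ)) • 1 :=
    fun β hβ => mul_self_eq_of_minPoly_eq hm hdeg (hcls hβ).2
  have hS : ∀ β ∈ S, a * β + b ∈ A := fun β hβ => by
    have h := hab β (hroot β hβ) 1
    rw [mul_one, eval_one, mul_one, mul_one] at h
    exact h ▸ hf β hβ
  have hstar : ∀ β ∈ starSet S A, a * β + b ∈ A := by
    rcases eq_or_ne a 0 with rfl | ha
    · have hb : b ∈ A := by simpa using hS α hα
      simpa using fun _ _ => hb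
    · intro β hβ
      have : C a * X + C b ∈ IntPolys S A := fun γ hγ => by simpa using hS γ hγ
      simpa using hlin _ this (degree_linear ha) β hβ
  rw [hab α (hroot α hα)]
  suffices h : ∀ β ∈ AddSubgroup.closure (unitsIn A), a * β * α + b * β ∈ A from h _ (hA (hg α hα))
  intro β hβ
  induction hβ using AddSubgroup.closure_induction with
  | mem u hu =>
    obtain ⟨hu, v, hv, huv, hvu⟩ := hu
    have := A.mul_mem (hstar (u * α * v) ⟨α, hα, u, v, hu, hv, huv, hvu, rfl⟩) hu
    simpa only [add_mul, mul_assoc, hvu, mul_one] using this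
  | zero => simp
  | add x y _ _ hx hy =>
    convert A.add_mem hx hy using 1
    noncomm_ring
  | neg x _ hx =>
    convert A.neg_mem hx using 1
    noncomm_ring

/-- If every linear polynomial in Int(S,R) is in Int(S*,R), then S is a ringset. -/
theorem stmt_11 (R : Set 𝔻) (hR : R = Lip ∨ R = Hur)
    (S : Set 𝔻) (hne : S.Nonempty) (hsub : S ⊂ R)
    (m : Polynomial ℤ) (hm : m.Monic) (hdeg : m.natDegree = 2)
    (hcls : S ⊆ classOf R m)
    (hlin : ∀ f ∈ IntPolys S R, f.degree = 1 → f ∈ IntPolys (starSet S R) R) :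
    IsRingset S R := by
  rcases hR with rfl | rfl
  · exact isRingset_of_linear (A := lipschitz) Lip_subset_closure_units hm hdeg hcls hlin
  · exact isRingset_of_linear (A := hurwitz) Hur_subset_closure_units hm hdeg hcls hlin
end
end

section
/- Let p be an odd prime and let A, B be nonzero 2×2 matrices over the field 𝔽_p such that A, B, and B−A are all nilpotent. Then A and B are nonzero scalar multiples of one another; that is, there exists a nonzero c ∈ 𝔽_p with B = cA. -/
noncomputable section

open Polynomial

theorem Matrix.det_eq_zero_of_isNilpotent {K n : Type*} [Field K] [Fintype n] [DecidableEq n]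
    [Nonempty n] {A : Matrix n n K} (hA : IsNilpotent A) : A.det = 0 := by
  obtain ⟨m, hm⟩ := hA
  refine eq_zero_of_pow_eq_zero (n := m) ?_
  rw [← Matrix.det_pow, hm, Matrix.det_zero]

theorem Matrix.trace_eq_zero_of_isNilpotent {K n : Type*} [Field K] [Fintype n] [DecidableEq n]
    {A : Matrix n n K} (hA : IsNilpotent A) : A.trace = 0 :=
  (Matrix.isNilpotent_trace_of_isNilpotent hA).eq_zero

/-- Two isotropic vectors of the quadratic form `a ^ 2 + b * c` which are orthogonal are
proportional; this is the case where the coordinate `b` of the first does not vanish. -/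
theorem proportional_of_isotropic_of_orthogonal {K : Type*} [Field K] {a b c x y z : K}
    (hb : b ≠ 0) (h₁ : a ^ 2 + b * c = 0) (h₂ : x ^ 2 + y * z = 0)
    (h₃ : 2 * a * x + b * z + c * y = 0) :
    x = y / b * a ∧ y = y / b * b ∧ z = y / b * c := by
  have hsq : (b * x - a * y) ^ 2 = 0 := by
    linear_combination b ^ 2 * h₂ - b * y * h₃ + y ^ 2 * h₁
  have hxy : b * x - a * y = 0 := eq_zero_of_pow_eq_zero hsq
  have hzc : b * (b * z - c * y) = 0 := by
    linear_combination b * h₃ - 2 * a * hxy - 2 * y * h₁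
  have hz : b * z - c * y = 0 := (mul_eq_zero.mp hzc).resolve_left hb
  refine ⟨?_, ?_, ?_⟩
  · field_simp
    linear_combination hxy
  · field_simp
  · field_simp
    linear_combination hz

/-- Over any field, nonzero nilpotent `2 × 2` matrices with nilpotent difference are
proportional. -/
theorem Matrix.exists_smul_eq_of_isNilpotent_sub {K : Type*} [Field K]
    {A B : Matrix (Fin 2) (Fin 2) K} (hA : A ≠ 0) (hB : B ≠ 0)
    (hAn : IsNilpotent A) (hBn : IsNilpotent B) (hBAn : IsNilpotent (B - A)) :
    ∃ c : K, c ≠ 0 ∧ B = c • A := by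
  suffices h : ∃ c : K, B = c • A by
    obtain ⟨c, rfl⟩ := h
    exact ⟨c, fun hc => hB (by rw [hc, zero_smul]), rfl⟩
  have tA := Matrix.trace_eq_zero_of_isNilpotent hAn
  have tB := Matrix.trace_eq_zero_of_isNilpotent hBn
  have dA := Matrix.det_eq_zero_of_isNilpotent hAn
  have dB := Matrix.det_eq_zero_of_isNilpotent hBn
  have dBA := Matrix.det_eq_zero_of_isNilpotent hBAn
  rw [Matrix.trace_fin_two] at tA tB
  rw [Matrix.det_fin_two] at dA dB dBA
  simp only [Matrix.sub_apply] at dBA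
  have eA : A 1 1 = -A 0 0 := by linear_combination tA
  have eB : B 1 1 = -B 0 0 := by linear_combination tB
  rw [eA] at dA
  rw [eB] at dB
  rw [eA, eB] at dBA
  have key : ∀ c : K, B 0 0 = c * A 0 0 → B 0 1 = c * A 0 1 → B 1 0 = c * A 1 0 → B = c • A := by
    intro c h₀₀ h₀₁ h₁₀
    ext i j
    fin_cases i <;> fin_cases j <;> simp [*]
  by_cases hb : A 0 1 = 0
  · by_cases hc : A 1 0 = 0
    · have ha : A 0 0 = 0 := by
        refine eq_zero_of_pow_eq_zero (n := 2) ?_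
        linear_combination -dA - A 1 0 * hb
      refine absurd ?_ hA
      ext i j
      fin_cases i <;> fin_cases j <;> simp [*]
    · obtain ⟨h₁, h₂, h₃⟩ := proportional_of_isotropic_of_orthogonal (a := A 0 0) (c := A 0 1)
        (x := B 0 0) (y := B 1 0) (z := B 0 1) hc (by linear_combination -dA)
        (by linear_combination -dB) (by linear_combination dBA - dA - dB)
      exact ⟨_, key _ h₁ h₃ h₂⟩
  · obtain ⟨h₁, h₂, h₃⟩ := proportional_of_isotropic_of_orthogonal (a := A 0 0) (c := A 1 0)
      (x := B 0 0) (y := B 0 1) (z := B 1 0) hb (by linear_combination -dA)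
      (by linear_combination -dB) (by linear_combination dBA - dA - dB)
    exact ⟨_, key _ h₁ h₂ h₃⟩

/-- Nonzero nilpotent 2×2 matrices over 𝔽_p (p odd) with nilpotent difference
are scalar multiples of one another. -/
theorem stmt_16 (p : ℕ) (hp : p.Prime) (hodd : p ≠ 2)
    (A B : Matrix (Fin 2) (Fin 2) (ZMod p)) (hA : A ≠ 0) (hB : B ≠ 0)
    (hAn : IsNilpotent A) (hBn : IsNilpotent B) (hBAn : IsNilpotent (B - A)) :
    ∃ c : ZMod p, c ≠ 0 ∧ B = c • A := by
  have : Fact p.Prime := ⟨hp⟩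
  exact Matrix.exists_smul_eq_of_isNilpotent_sub hA hB hAn hBn hBAn
end
end

section
/- Let R be either L or H and let S be a reduced proper subset of R. If there is an odd prime p such that p divides Γ(S), then S is not a ringset of R. (Here Γ(S) = 0 when S is a singleton, so singleton reduced sets are covered.) -/
noncomputable section

open Polynomial

/-- The quaternion with the given coordinates. -/
def quat (a b c d : ℚ) : 𝔻 := ⟨a, b, c, d⟩

section coordinates

variable (a b c d : ℚ)

@[simp] lemma quat_re : (quat a b c d).re = a := rfl
@[simp] lemma quat_imI : (quat a b c d).imI = b := rfl
@[simp] lemma quat_imJ : (quat a b c d).imJ = c := rfl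
@[simp] lemma quat_imK : (quat a b c d).imK = d := rfl

end coordinates

lemma qi_eq_quat : qi = quat 0 1 0 0 := rfl
lemma qj_eq_quat : qj = quat 0 0 1 0 := rfl
lemma qk_eq_quat : qk = quat 0 0 0 1 := rfl

lemma mk_half_mem_lip {a b c d : ℤ} (ha : Even a) (hb : Even b) (hc : Even c) (hd : Even d) :
    quat (a / 2) (b / 2) (c / 2) (d / 2) ∈ Lip := by
  obtain ⟨a, rfl⟩ := ha
  obtain ⟨b, rfl⟩ := hb
  obtain ⟨c, rfl⟩ := hc
  obtain ⟨d, rfl⟩ := hd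
  exact ⟨⟨a, by rw [quat_re]; push_cast; ring⟩, ⟨b, by rw [quat_imI]; push_cast; ring⟩,
    ⟨c, by rw [quat_imJ]; push_cast; ring⟩, ⟨d, by rw [quat_imK]; push_cast; ring⟩⟩

lemma mk_half_mem_hurOff {a b c d : ℤ} (ha : Odd a) (hb : Odd b) (hc : Odd c) (hd : Odd d) :
    quat (a / 2) (b / 2) (c / 2) (d / 2) ∈ HurOff := by
  obtain ⟨a, rfl⟩ := ha
  obtain ⟨b, rfl⟩ := hb
  obtain ⟨c, rfl⟩ := hc
  obtain ⟨d, rfl⟩ := hd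
  exact ⟨⟨a, by rw [quat_re]; push_cast; ring⟩, ⟨b, by rw [quat_imI]; push_cast; ring⟩,
    ⟨c, by rw [quat_imJ]; push_cast; ring⟩, ⟨d, by rw [quat_imK]; push_cast; ring⟩⟩

lemma exists_eq_half_of_mem_lip {α : 𝔻} (h : α ∈ Lip) :
    ∃ a b c d : ℤ, α = quat (a / 2) (b / 2) (c / 2) (d / 2) ∧ Even a ∧ Even b ∧ Even c ∧ Even d := by
  obtain ⟨⟨a, ha⟩, ⟨b, hb⟩, ⟨c, hc⟩, ⟨d, hd⟩⟩ := h
  refine ⟨2 * a, 2 * b, 2 * c, 2 * d, ?_, by simp, by simp, by simp, by simp⟩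
  ext <;> simp [*]

lemma exists_eq_half_of_mem_hurOff {α : 𝔻} (h : α ∈ HurOff) :
    ∃ a b c d : ℤ, α = quat (a / 2) (b / 2) (c / 2) (d / 2) ∧ Odd a ∧ Odd b ∧ Odd c ∧ Odd d := by
  obtain ⟨⟨a, ha⟩, ⟨b, hb⟩, ⟨c, hc⟩, ⟨d, hd⟩⟩ := h
  refine ⟨2 * a + 1, 2 * b + 1, 2 * c + 1, 2 * d + 1, ?_, by simp, by simp, by simp, by simp⟩
  ext <;> simp [*] <;> ring

/-- The Lipschitz quaternions as a subring of the rational quaternions. -/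
def lipSubring : Subring 𝔻 where
  carrier := Lip
  zero_mem' := ⟨⟨0, Int.cast_zero.symm⟩, ⟨0, Int.cast_zero.symm⟩, ⟨0, Int.cast_zero.symm⟩,
    ⟨0, Int.cast_zero.symm⟩⟩
  one_mem' := ⟨⟨1, Int.cast_one.symm⟩, ⟨0, Int.cast_zero.symm⟩, ⟨0, Int.cast_zero.symm⟩,
    ⟨0, Int.cast_zero.symm⟩⟩
  add_mem' := by
    rintro _ _ ⟨⟨a, ha⟩, ⟨b, hb⟩, ⟨c, hc⟩, ⟨d, hd⟩⟩ ⟨⟨a', ha'⟩, ⟨b', hb'⟩, ⟨c', hc'⟩, ⟨d', hd'⟩⟩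
    exact ⟨⟨a + a', by simp [*]⟩, ⟨b + b', by simp [*]⟩, ⟨c + c', by simp [*]⟩,
      ⟨d + d', by simp [*]⟩⟩
  neg_mem' := by
    rintro _ ⟨⟨a, ha⟩, ⟨b, hb⟩, ⟨c, hc⟩, ⟨d, hd⟩⟩
    exact ⟨⟨-a, by simp [*]⟩, ⟨-b, by simp [*]⟩, ⟨-c, by simp [*]⟩, ⟨-d, by simp [*]⟩⟩
  mul_mem' := by
    rintro _ _ ⟨⟨a, ha⟩, ⟨b, hb⟩, ⟨c, hc⟩, ⟨d, hd⟩⟩ ⟨⟨a', ha'⟩, ⟨b', hb'⟩, ⟨c', hc'⟩, ⟨d', hd'⟩⟩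
    exact ⟨⟨a * a' - b * b' - c * c' - d * d', by simp [*]⟩,
      ⟨a * b' + b * a' + c * d' - d * c', by simp [*]⟩,
      ⟨a * c' - b * d' + c * a' + d * b', by simp [*]⟩,
      ⟨a * d' + b * c' - c * b' + d * a', by simp [*]⟩⟩

lemma mem_lipSubring {α : 𝔻} : α ∈ lipSubring ↔ α ∈ Lip := Iff.rfl

lemma mk_int_mem_lip (a b c d : ℤ) : quat a b c d ∈ lipSubring :=
  ⟨⟨a, rfl⟩, ⟨b, rfl⟩, ⟨c, rfl⟩, ⟨d, rfl⟩⟩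

lemma qi_mem_lip : qi ∈ lipSubring := by simpa [qi_eq_quat] using mk_int_mem_lip 0 1 0 0
lemma qj_mem_lip : qj ∈ lipSubring := by simpa [qj_eq_quat] using mk_int_mem_lip 0 0 1 0
lemma qk_mem_lip : qk ∈ lipSubring := by simpa [qk_eq_quat] using mk_int_mem_lip 0 0 0 1

lemma two_smul_mem_lip {α : 𝔻} (h : α ∈ Hur) : (2 : ℚ) • α ∈ lipSubring := by
  obtain ⟨a, b, c, d, rfl⟩ : ∃ a b c d : ℤ, α = quat (a / 2) (b / 2) (c / 2) (d / 2) := by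
    rcases h with h | h
    · obtain ⟨a, b, c, d, h, -⟩ := exists_eq_half_of_mem_lip h
      exact ⟨a, b, c, d, h⟩
    · obtain ⟨a, b, c, d, h, -⟩ := exists_eq_half_of_mem_hurOff h
      exact ⟨a, b, c, d, h⟩
  convert mk_int_mem_lip a b c d using 1
  ext <;> simp <;> ring

/-- Two-sided averaging over the basis `1, i, j, k` extracts the real part. -/
lemma four_re_smul_eq (γ ξ : 𝔻) :
    (4 * γ.re) • ξ = γ * ξ - qi * (γ * (qi * ξ)) - qj * (γ * (qj * ξ)) - qk * (γ * (qk * ξ)) := by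
  ext <;> simp [qi_eq_quat, qj_eq_quat, qk_eq_quat] <;> ring

lemma re_smul_mem_lip {γ ξ ε : 𝔻} {r : ℚ} (hε : ε ∈ lipSubring)
    (h : ∀ u ∈ lipSubring, r • (γ * (u * ξ)) ∈ lipSubring) :
    (4 * r * (ε * γ).re) • ξ ∈ lipSubring := by
  have key : (4 * r * (ε * γ).re) • ξ = ε * (r • (γ * (1 * ξ))) - qi * (ε * (r • (γ * (qi * ξ))))
      - qj * (ε * (r • (γ * (qj * ξ)))) - qk * (ε * (r • (γ * (qk * ξ)))) := by
    have := congrArg (r • ·) (four_re_smul_eq (ε * γ) ξ)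
    simp only [smul_sub, smul_smul] at this
    simp only [mul_smul_comm, one_mul, ← mul_assoc] at this ⊢
    rw [← this]
    ring_nf
  rw [key]
  have hm := fun {u : 𝔻} (hu : u ∈ lipSubring) ↦ mul_mem hε (h u hu)
  exact sub_mem (sub_mem (sub_mem (hm (one_mem _)) (mul_mem qi_mem_lip (hm qi_mem_lip)))
    (mul_mem qj_mem_lip (hm qj_mem_lip))) (mul_mem qk_mem_lip (hm qk_mem_lip))

lemma dvd_of_isIntQ {p : ℕ} (hp : p.Prime) (hodd : p ≠ 2) {n b : ℤ} (hn : ¬ (p : ℤ) ∣ n)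
    (h : isIntQ (4 * (2 / p) * n * b)) : (p : ℤ) ∣ b := by
  obtain ⟨z, hz⟩ := h
  have hp0 : (p : ℚ) ≠ 0 := by exact_mod_cast hp.ne_zero
  field_simp at hz
  have hz' : 2 ^ 3 * n * b = p * z := by
    have : ((2 ^ 3 * n * b : ℤ) : ℚ) = ((p * z : ℤ) : ℚ) := by push_cast; linarith
    exact_mod_cast this
  have hpp := Nat.prime_iff_prime_int.mp hp
  rcases hpp.dvd_or_dvd (Dvd.intro _ hz'.symm) with h | h
  · rcases hpp.dvd_or_dvd h with h | h
    · have := Int.natCast_dvd_natCast.mp (by exact_mod_cast hpp.dvd_of_dvd_pow h : (p : ℤ) ∣ (2 : ℕ))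
      exact absurd ((Nat.prime_dvd_prime_iff_eq hp Nat.prime_two).mp this) hodd
    · exact absurd h hn
  · exact h

/-- A quaternion `γ` that is nonzero modulo `p` and annihilates all commutators with `α` modulo `p`
forces `α` to be central modulo `p`. -/
lemma dvd_imag_of_commutators {p : ℕ} (hp : p.Prime) (hodd : p ≠ 2) {γ ε : 𝔻} {n a b c d : ℤ}
    (hε : ε ∈ lipSubring) (hre : (ε * γ).re = n) (hn : ¬ (p : ℤ) ∣ n)
    (h : ∀ u ∈ lipSubring, (2 / p : ℚ) • (γ * (u * quat (a / 2) (b / 2) (c / 2) (d / 2) -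
      quat (a / 2) (b / 2) (c / 2) (d / 2) * u)) ∈ lipSubring) :
    (p : ℤ) ∣ b ∧ (p : ℤ) ∣ c ∧ (p : ℤ) ∣ d := by
  set α : 𝔻 := quat (a / 2) (b / 2) (c / 2) (d / 2) with hα
  have key : ∀ v ∈ lipSubring, (4 * (2 / p : ℚ) * n) • (v * α - α * v) ∈ lipSubring := by
    intro v hv
    rw [← hre]
    refine re_smul_mem_lip hε fun u hu ↦ ?_
    have := sub_mem (h _ (mul_mem hu hv)) (mul_mem (h u hu) hv)
    convert this using 1
    rw [smul_mul_assoc, ← smul_sub]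
    congr 1
    noncomm_ring
  have hi := key qi qi_mem_lip
  have hj := key qj qj_mem_lip
  refine ⟨dvd_of_isIntQ hp hodd (b := b) hn ?_, dvd_of_isIntQ hp hodd (b := c) hn ?_,
    dvd_of_isIntQ hp hodd (b := d) hn ?_⟩
  · obtain ⟨z, hz⟩ := hj.2.2.2
    refine ⟨-z, ?_⟩
    simp [hα, qj_eq_quat] at hz
    push_cast
    rw [← hz]
    ring
  · obtain ⟨z, hz⟩ := hi.2.2.2
    refine ⟨z, ?_⟩
    simp [hα, qi_eq_quat] at hz
    rw [← hz]
  · obtain ⟨z, hz⟩ := hj.2.1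
    refine ⟨z, ?_⟩
    simp [hα, qj_eq_quat] at hz
    rw [← hz]

lemma dvd_of_dvd_gam {S : Set 𝔻} {p : ℕ} (h : p ∣ gam S) {n : ℤ} (hn : n ∈ normsOf S) :
    (p : ℤ) ∣ n := by
  rcases eq_or_ne n 0 with rfl | hn0
  · exact dvd_zero _
  have hb : BddAbove {g : ℕ | ∀ t ∈ normsOf S, (g : ℤ) ∣ t} :=
    ⟨n.natAbs, fun g hg ↦ Nat.le_of_dvd (by omega) (Int.natCast_dvd.mp (hg n hn))⟩
  have hmem : gam S ∈ {g : ℕ | ∀ t ∈ normsOf S, (g : ℤ) ∣ t} :=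
    Nat.sSup_mem ⟨1, by simp⟩ hb
  exact (Int.natCast_dvd_natCast.mpr h).trans (hmem n hn)

lemma exists_re_eq_half {S R : Set 𝔻} {m : ℤ[X]} (hm : m.Monic) (hdeg : m.natDegree = 2)
    (hS : S ⊆ classOf R m) : ∃ t : ℤ, ∀ α ∈ S, α.re = t / 2 := by
  refine ⟨-m.coeff 1, fun α hα ↦ ?_⟩
  have h := (hS hα).2
  unfold minPoly at h
  split_ifs at h
  · have := congrArg natDegree h
    rw [natDegree_X_sub_C, hm.natDegree_map, hdeg] at this
    omega
  · have := congrArg (coeff · 1) h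
    simp [coeff_C, coeff_X_pow] at this
    push_cast
    linarith

/-- Vectors spanning a totally isotropic subspace of the standard ternary form modulo a prime are
proportional. -/
lemma dvd_cross_of_isotropic {p x y z x' y' z' : ℤ} (hp : Prime p)
    (h : p ∣ x ^ 2 + y ^ 2 + z ^ 2) (h' : p ∣ x' ^ 2 + y' ^ 2 + z' ^ 2)
    (hB : p ∣ x * x' + y * y' + z * z') : p ∣ y * z' - z * y' := by
  refine hp.dvd_of_dvd_pow (n := 2) ?_
  obtain ⟨u, hu⟩ := h
  obtain ⟨v, hv⟩ := h'
  obtain ⟨w, hw⟩ := hB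
  exact ⟨u * (y' ^ 2 + z' ^ 2) - v * x ^ 2 - w * (y * y' + z * z' - x * x'), by
    linear_combination (y' ^ 2 + z' ^ 2) * hu - x ^ 2 * hv - (y * y' + z * z' - x * x') * hw⟩

lemma inv_smul_mul_mem_lip {p : ℕ} (hp : p.Prime) (hodd : p ≠ 2) {x y z x' y' z' : ℤ}
    (h : (p : ℤ) ∣ x ^ 2 + y ^ 2 + z ^ 2) (h' : (p : ℤ) ∣ x' ^ 2 + y' ^ 2 + z' ^ 2)
    (hB : (p : ℤ) ∣ 2 * (x * x' + y * y' + z * z')) :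
    (p⁻¹ : ℚ) • (quat 0 x y z * quat 0 x' y' z') ∈ lipSubring := by
  have hpp := Nat.prime_iff_prime_int.mp hp
  have hp0 : (p : ℚ) ≠ 0 := by exact_mod_cast hp.ne_zero
  replace hB : (p : ℤ) ∣ x * x' + y * y' + z * z' := by
    refine (hpp.dvd_or_dvd hB).resolve_left fun h2 ↦ hodd ?_
    exact (Nat.prime_dvd_prime_iff_eq hp Nat.prime_two).mp (by exact_mod_cast h2)
  obtain ⟨r, hr⟩ := hB
  obtain ⟨s, hs⟩ := dvd_cross_of_isotropic hpp h h' ⟨r, hr⟩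
  obtain ⟨t, ht⟩ := dvd_cross_of_isotropic (x := y) (y := z) (z := x) (x' := y') (y' := z')
    (z' := x') hpp (by convert h using 1; ring) (by convert h' using 1; ring)
    ⟨r, by linarith⟩
  obtain ⟨u, hu⟩ := dvd_cross_of_isotropic (x := z) (y := x) (z := y) (x' := z') (y' := x')
    (z' := y') hpp (by convert h using 1; ring) (by convert h' using 1; ring)
    ⟨r, by linarith⟩
  have hr' : (x * x' + y * y' + z * z' : ℚ) = p * r := by exact_mod_cast hr
  have hs' : (y * z' - z * y' : ℚ) = p * s := by exact_mod_cast hs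
  have ht' : (z * x' - x * z' : ℚ) = p * t := by exact_mod_cast ht
  have hu' : (x * y' - y * x' : ℚ) = p * u := by exact_mod_cast hu
  convert mk_int_mem_lip (-r) s t u using 1
  ext <;> simp <;> field_simp <;> linarith

/-- An annihilator of the differences of `S` modulo `p` that is itself nonzero modulo `p`. -/
lemma exists_annihilator {S : Set 𝔻} {p : ℕ} (hp : p.Prime) (hodd : p ≠ 2)
    (hdvd : ∀ n ∈ normsOf S, (p : ℤ) ∣ n)
    (hdiff : ∀ α ∈ S, ∀ β ∈ S, ∃ x y z : ℤ, β - α = quat 0 x y z) :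
    ∃ γ : 𝔻, (∀ α ∈ S, ∀ β ∈ S, (p⁻¹ : ℚ) • (γ * (β - α)) ∈ lipSubring) ∧
      ∃ ε ∈ lipSubring, ∃ n : ℤ, (ε * γ).re = n ∧ ¬ (p : ℤ) ∣ n := by
  have hp0 : (p : ℚ) ≠ 0 := by exact_mod_cast hp.ne_zero
  have hnorm : ∀ α ∈ S, ∀ β ∈ S, ∀ x y z : ℤ, β - α = quat 0 x y z →
      (p : ℤ) ∣ x ^ 2 + y ^ 2 + z ^ 2 := fun α hα β hβ x y z h ↦
    hdvd _ ⟨β - α, ⟨β, hβ, α, hα, rfl⟩, by rw [h]; simp [qnorm]⟩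
  by_cases H : ∃ α ∈ S, ∃ β ∈ S, ∃ x y z : ℤ, β - α = quat 0 x y z ∧
      ¬ ((p : ℤ) ∣ x ∧ (p : ℤ) ∣ y ∧ (p : ℤ) ∣ z)
  · obtain ⟨α, hα, β, hβ, x, y, z, h, hxyz⟩ := H
    refine ⟨quat 0 x y z, ?_, ?_⟩
    · have key : ∀ ξ ∈ S, (p⁻¹ : ℚ) • (quat 0 x y z * (ξ - α)) ∈ lipSubring := by
        intro ξ hξ
        obtain ⟨x', y', z', h'⟩ := hdiff α hα ξ hξ
        have h1 := hnorm α hα β hβ _ _ _ h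
        have h2 := hnorm α hα ξ hξ _ _ _ h'
        have h3 := hnorm β hβ ξ hξ (x' - x) (y' - y) (z' - z) <| by
          rw [← sub_sub_sub_cancel_right ξ β α, h, h']
          ext <;> simp
        rw [h']
        refine inv_smul_mul_mem_lip hp hodd h1 h2 ?_
        rw [show 2 * (x * x' + y * y' + z * z') = x ^ 2 + y ^ 2 + z ^ 2 + (x' ^ 2 + y' ^ 2 + z' ^ 2) -
          ((x' - x) ^ 2 + (y' - y) ^ 2 + (z' - z) ^ 2) by ring]
        exact dvd_sub (dvd_add h1 h2) h3
      intro ξ hξ ζ hζ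
      rw [← sub_sub_sub_cancel_right ζ ξ α, mul_sub, smul_sub]
      exact sub_mem (key ζ hζ) (key ξ hξ)
    · by_cases hx : (p : ℤ) ∣ x
      · by_cases hy : (p : ℤ) ∣ y
        · exact ⟨qk, qk_mem_lip, -z, by simp [qk_eq_quat], fun hz ↦ hxyz ⟨hx, hy, by simpa using hz⟩⟩
        · exact ⟨qj, qj_mem_lip, -y, by simp [qj_eq_quat], by simpa using hy⟩
      · exact ⟨qi, qi_mem_lip, -x, by simp [qi_eq_quat], by simpa using hx⟩
  · push Not at H
    refine ⟨1, fun α hα β hβ ↦ ?_, 1, one_mem _, 1, by rw [one_mul, Quaternion.re_one, Int.cast_one], ?_⟩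
    · obtain ⟨x, y, z, h⟩ := hdiff α hα β hβ
      obtain ⟨⟨x, rfl⟩, ⟨y, rfl⟩, ⟨z, rfl⟩⟩ := H α hα β hβ x y z h
      rw [one_mul, h]
      convert mk_int_mem_lip 0 x y z using 1
      ext <;> simp [hp0]
    · exact fun h ↦ hp.one_lt.ne' (by exact_mod_cast Int.eq_one_of_dvd_one (by positivity) h)

/-- Multiplying the degree-one integer-valued polynomials `γ (x - α) / p` by Lipschitz constants
produces commutator conditions on `α`. -/
lemma commutator_mem_of_isRingset {R S : Set 𝔻} (hLip : Lip ⊆ R) (hring : IsRingset S R) {p : ℕ}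
    {γ : 𝔻} (hγ : ∀ α ∈ S, ∀ β ∈ S, (p⁻¹ : ℚ) • (γ * (β - α)) ∈ lipSubring) {α u : 𝔻}
    (hα : α ∈ S) (hu : u ∈ lipSubring) : (p⁻¹ : ℚ) • (γ * (u * α - α * u)) ∈ R := by
  have h := hring (C ((p⁻¹ : ℚ) • γ) * X - C ((p⁻¹ : ℚ) • γ * α)) (fun β hβ ↦ hLip ?_)
    (C u) (fun β _ ↦ hLip (by simpa [mem_lipSubring] using hu)) α hα
  · convert h using 1
    rw [sub_mul, mul_assoc, X_mul_C, ← mul_assoc, ← C_mul, ← C_mul, eval_sub, eval_mul_X,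
      eval_C, eval_C]
    simp only [smul_mul_assoc, ← smul_sub]
    congr 1
    noncomm_ring
  · rw [← mem_lipSubring]
    convert hγ α hα β hβ using 1
    rw [eval_sub, eval_mul_X, eval_C, eval_C, smul_mul_assoc, smul_mul_assoc, ← smul_sub, mul_sub]

lemma even_or_odd_half_coords {R : Set 𝔻} (hR : R = Lip ∨ R = Hur) {α : 𝔻} (hα : α ∈ R) {t : ℤ}
    (ht : α.re = t / 2) : ∃ b c d : ℤ, α = quat (t / 2) (b / 2) (c / 2) (d / 2) ∧
      ((Even t ∧ Even b ∧ Even c ∧ Even d) ∨ R = Hur ∧ Odd t ∧ Odd b ∧ Odd c ∧ Odd d) := by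
  have h : α ∈ Lip ∨ R = Hur ∧ α ∈ HurOff := by
    rcases hR with rfl | rfl
    · exact Or.inl hα
    · exact hα.imp_right fun h ↦ ⟨rfl, h⟩
  rcases h with h | ⟨hR, h⟩
  · obtain ⟨a, b, c, d, rfl, ha, hb, hc, hd⟩ := exists_eq_half_of_mem_lip h
    obtain rfl : a = t := by simpa using ht
    exact ⟨b, c, d, rfl, Or.inl ⟨ha, hb, hc, hd⟩⟩
  · obtain ⟨a, b, c, d, rfl, ha, hb, hc, hd⟩ := exists_eq_half_of_mem_hurOff h
    obtain rfl : a = t := by simpa using ht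
    exact ⟨b, c, d, rfl, Or.inr ⟨hR, ha, hb, hc, hd⟩⟩

lemma exists_translate_subset_scale {R S : Set 𝔻} (hR : R = Lip ∨ R = Hur) (hLip : Lip ⊆ R)
    (hS : S ⊆ R) {t : ℤ} (ht : ∀ α ∈ S, α.re = t / 2) {p : ℕ} (hp : Odd (p : ℤ))
    (hdvd : ∀ b c d : ℤ, quat (t / 2) (b / 2) (c / 2) (d / 2) ∈ S →
      (p : ℤ) ∣ b ∧ (p : ℤ) ∣ c ∧ (p : ℤ) ∣ d) : ∃ a : ℤ, transSet S a ⊆ scaleSet p R := by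
  have hp' : ¬ Even (p : ℤ) := Int.not_even_iff_odd.mpr hp
  rcases Int.even_or_odd t with hte | hto
  · obtain ⟨s, rfl⟩ := hte
    refine ⟨-s, ?_⟩
    rintro _ ⟨α, hα, rfl⟩
    obtain ⟨b, c, d, rfl, ⟨-, hb, hc, hd⟩ | ⟨-, h, -⟩⟩ := even_or_odd_half_coords hR (hS hα) (ht α hα)
    · obtain ⟨⟨b, rfl⟩, ⟨c, rfl⟩, ⟨d, rfl⟩⟩ := hdvd b c d hα
      simp only [Int.even_mul, hp', false_or] at hb hc hd
      refine ⟨_, hLip (mk_half_mem_lip Even.zero hb hc hd), ?_⟩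
      ext <;> simp <;> ring
    · exact absurd (by simp) (Int.not_even_iff_odd.mpr h)
  · obtain ⟨s, hs⟩ := hp.sub_odd hto
    refine ⟨s, ?_⟩
    rintro _ ⟨α, hα, rfl⟩
    obtain ⟨b, c, d, rfl, ⟨h, -⟩ | ⟨hRH, -, hb, hc, hd⟩⟩ :=
      even_or_odd_half_coords hR (hS hα) (ht α hα)
    · exact absurd h (Int.not_even_iff_odd.mpr hto)
    · obtain ⟨⟨b, rfl⟩, ⟨c, rfl⟩, ⟨d, rfl⟩⟩ := hdvd b c d hα
      simp only [Int.odd_mul, hp, true_and] at hb hc hd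
      rw [hRH]
      refine ⟨_, Or.inr (mk_half_mem_hurOff odd_one hb hc hd), ?_⟩
      have hs' : (p - t : ℚ) = s + s := by exact_mod_cast hs
      ext <;> simp <;> linarith

/-- If an odd prime divides Γ(S) for a reduced set S, then S is not a ringset. -/
theorem stmt_17 (R : Set 𝔻) (hR : R = Lip ∨ R = Hur)
    (S : Set 𝔻) (hsub : S ⊂ R) (hred : IsReducedIn S R)
    (p : ℕ) (hp : p.Prime) (hodd : p ≠ 2) (hdvd : p ∣ gam S) :
    ¬ IsRingset S R := by
  have hLip : Lip ⊆ R := by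
    rcases hR with rfl | rfl
    exacts [subset_rfl, Set.subset_union_left]
  have hHur : R ⊆ Hur := by
    rcases hR with rfl | rfl
    exacts [Set.subset_union_left, subset_rfl]
  intro hring
  obtain ⟨⟨m, hm, hdeg, hS⟩, hprim⟩ := hred
  obtain ⟨t, ht⟩ := exists_re_eq_half hm hdeg hS
  have hdiff : ∀ α ∈ S, ∀ β ∈ S, ∃ x y z : ℤ, β - α = quat 0 x y z := by
    intro α hα β hβ
    obtain ⟨b, c, d, rfl, h⟩ := even_or_odd_half_coords hR (hsub.1 hα) (ht α hα)
    obtain ⟨b', c', d', rfl, h'⟩ := even_or_odd_half_coords hR (hsub.1 hβ) (ht β hβ)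
    obtain ⟨⟨x, hx⟩, ⟨y, hy⟩, ⟨z, hz⟩⟩ : Even (b' - b) ∧ Even (c' - c) ∧ Even (d' - d) := by
      grind
    have hx' : (b' - b : ℚ) = x + x := by exact_mod_cast hx
    have hy' : (c' - c : ℚ) = y + y := by exact_mod_cast hy
    have hz' : (d' - d : ℚ) = z + z := by exact_mod_cast hz
    refine ⟨x, y, z, ?_⟩
    ext <;> simp <;> linarith
  obtain ⟨γ, hγ, ε, hε, n, hre, hn⟩ :=
    exists_annihilator hp hodd (fun _ ↦ dvd_of_dvd_gam hdvd) hdiff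
  obtain ⟨a, ha⟩ := exists_translate_subset_scale hR hLip hsub.1 ht
    (by exact_mod_cast hp.odd_of_ne_two hodd) fun b c d hα ↦
      dvd_imag_of_commutators hp hodd hε hre hn fun u hu ↦ by
        simpa only [smul_smul, ← div_eq_mul_inv] using
          two_smul_mem_lip (hHur (commutator_mem_of_isRingset hLip hring hγ hα hu))
  exact hprim a p (by exact_mod_cast hp.two_le) ha
end
end
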